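/- Let $c = (c_0,c_1)$ and $d = (d_0,d_1)$ be vectors of indeterminates, write $c_x = c_0x_0 + c_1x_1$, $c_y = c_0y_0+c_1y_1$, similarly for $d$, and write $\omega = x_0y_1 - x_1y_0$ and $(cd) = c_0d_1 - c_1d_0$. Then for integers $r \ge 2$, $e \ge 1$, $0 \le 2p \le re$, $0 \le 2p' \le (r+1)e$ with $p \le p' \le p + e$ and $p'+p \le re$, the expression $\left.\Omega^{2p'}\big(\omega^{2p}\,c_x^{re-2p}c_y^{re-2p}d_x^e d_y^e\big)\right|_{y:=x}$ equals $\mathcal{N}^{II}_{r,e,p',p}\,(cd)^{2(p'-p)}\,c_x^{2(re-p'-p)}\,d_x^{2(e-p'+p)}$ for some nonzero rational constant $\mathcal{N}^{II}_{r,e,p',p}$. -/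

import Mathlib

open Finset MvPolynomial

/-- Variables: `X 0 = x₀, X 1 = x₁, X 2 = y₀, X 3 = y₁, X 4 = c₀, X 5 = c₁,
X 6 = d₀, X 7 = d₁`.  Cayley's Omega operator `∂x₀∂y₁ - ∂y₀∂x₁`. -/
noncomputable def Omega : Module.End ℚ (MvPolynomial (Fin 8) ℚ) :=
  (MvPolynomial.pderiv (0 : Fin 8)).toLinearMap * (MvPolynomial.pderiv (3 : Fin 8)).toLinearMap -
    (MvPolynomial.pderiv (2 : Fin 8)).toLinearMap * (MvPolynomial.pderiv (1 : Fin 8)).toLinearMap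

noncomputable def cx : MvPolynomial (Fin 8) ℚ := X 4 * X 0 + X 5 * X 1
noncomputable def cy : MvPolynomial (Fin 8) ℚ := X 4 * X 2 + X 5 * X 3
noncomputable def dx : MvPolynomial (Fin 8) ℚ := X 6 * X 0 + X 7 * X 1
noncomputable def dy : MvPolynomial (Fin 8) ℚ := X 6 * X 2 + X 7 * X 3
noncomputable def ω : MvPolynomial (Fin 8) ℚ := X 0 * X 3 - X 1 * X 2
noncomputable def cd : MvPolynomial (Fin 8) ℚ := X 4 * X 7 - X 5 * X 6

/-- The reciprocal factorial, extended by zero to negative integers. -/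
noncomputable def invFactorial (n : ℤ) : ℚ := if n < 0 then 0 else ((n.toNat.factorial : ℚ))⁻¹

lemma invFactorial_of_neg {n : ℤ} (h : n < 0) : invFactorial n = 0 := if_pos h

lemma invFactorial_natCast (n : ℕ) : invFactorial n = ((n.factorial : ℚ))⁻¹ := by
  simp [invFactorial]

lemma invFactorial_sub_one (n : ℤ) : invFactorial (n - 1) = n * invFactorial n := by
  rcases lt_trichotomy n 0 with h | rfl | h
  · rw [invFactorial_of_neg h, invFactorial_of_neg (by omega), mul_zero]
  · simp [invFactorial]
  · obtain ⟨m, rfl⟩ : ∃ m : ℕ, n = m + 1 := ⟨(n - 1).toNat, by omega⟩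
    have h1 : invFactorial ((m : ℤ) + 1) = (((m + 1).factorial : ℕ) : ℚ)⁻¹ := by
      exact_mod_cast invFactorial_natCast (m + 1)
    rw [add_sub_cancel_right, h1, invFactorial_natCast, Nat.factorial_succ]
    push_cast
    have : (m : ℚ) + 1 ≠ 0 := by positivity
    field_simp

/-- The summand of Dixon's well-poised alternating sum, normalised by reciprocal factorials. -/
noncomputable def dixonTerm (a b c t : ℤ) : ℚ :=
  (-1) ^ t * (invFactorial (a + t) * invFactorial (a - t)) *
    (invFactorial (b + t) * invFactorial (b - t)) * (invFactorial (c + t) * invFactorial (c - t))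

/-- The telescoping companion of `dixonTerm`. -/
noncomputable def dixonCert (a b c t : ℤ) : ℚ :=
  -(1 / 2) * ((-1) ^ t * (invFactorial (a + t) * invFactorial (a + 1 - t)) *
    (invFactorial (b + t - 1) * invFactorial (b - t)) *
    (invFactorial (c + t - 1) * invFactorial (c - t)))

lemma dixonTerm_telescope (a b c t : ℤ) :
    (a + 1) * (a + b + 1) * (a + c + 1) * dixonTerm (a + 1) b c t
      - (a + b + c + 1) * dixonTerm a b c t = dixonCert a b c (t + 1) - dixonCert a b c t := by
  have ha : invFactorial (a + t) = (a + 1 + t) * invFactorial (a + 1 + t) := by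
    have := invFactorial_sub_one (a + 1 + t)
    rw [show a + 1 + t - 1 = a + t by ring] at this
    simpa using this
  have ha' : invFactorial (a - t) = (a + 1 - t) * invFactorial (a + 1 - t) := by
    have := invFactorial_sub_one (a + 1 - t)
    rw [show a + 1 - t - 1 = a - t by ring] at this
    simpa using this
  have hp (n : ℤ) : invFactorial (n + t - 1) = (n + t) * invFactorial (n + t) := by
    simpa using invFactorial_sub_one (n + t)
  have hm (n : ℤ) : invFactorial (n - (t + 1)) = (n - t) * invFactorial (n - t) := by
    have := invFactorial_sub_one (n - t)
    rw [show n - t - 1 = n - (t + 1) by ring] at this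
    simpa using this
  have hz : (-1 : ℚ) ^ (t + 1) = -(-1) ^ t := by
    rw [zpow_add_one₀ (by norm_num)]; ring
  unfold dixonTerm dixonCert
  rw [hp, hp, hm b, hm c, hz, show a + (t + 1) = a + 1 + t by ring,
    show a + 1 - (t + 1) = a - t by ring, show b + (t + 1) - 1 = b + t by ring,
    show c + (t + 1) - 1 = c + t by ring, ha, ha']
  ring

lemma sum_dixonTerm_pos (N b c a : ℕ) (ha : a ≤ N) :
    0 < ∑ i ∈ range (2 * N + 1), dixonTerm a b c ((i : ℤ) - N) := by
  induction a with
  | zero =>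
    rw [Finset.sum_eq_single N]
    · simp only [dixonTerm, sub_self, add_zero, sub_zero, zpow_zero, invFactorial_natCast]
      positivity
    · intro i _ hi
      rcases lt_or_gt_of_ne hi with h | h
      · simp [dixonTerm, invFactorial_of_neg (show ((i : ℤ) - N) < 0 by omega)]
      · simp [dixonTerm, invFactorial_of_neg (show ((N : ℤ) - i) < 0 by omega)]
    · intro h
      exact absurd (mem_range.2 (by omega)) h
  | succ a ih =>
    have ih := ih (by omega)
    have key : ∑ i ∈ range (2 * N + 1), (((a : ℚ) + 1) * (a + b + 1) * (a + c + 1) *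
        dixonTerm ((a : ℤ) + 1) b c ((i : ℤ) - N)
        - ((a : ℚ) + b + c + 1) * dixonTerm a b c ((i : ℤ) - N)) = 0 := by
      have h1 (i : ℕ) := dixonTerm_telescope a b c ((i : ℤ) - N)
      push_cast at h1
      simp only [h1]
      have h2 := Finset.sum_range_sub (fun i : ℕ => dixonCert a b c ((i : ℤ) - N)) (2 * N + 1)
      have h3 (i : ℕ) : ((i + 1 : ℕ) : ℤ) - N = (i : ℤ) - N + 1 := by push_cast; ring
      simp only [h3] at h2
      rw [h2]
      have e1 : dixonCert a b c (((2 * N : ℕ) : ℤ) - N + 1) = 0 := by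
        simp [dixonCert, invFactorial_of_neg (show ((a : ℤ) - (2 * N - N)) < 0 by omega)]
      have e2 : dixonCert a b c (((0 : ℕ) : ℤ) - N) = 0 := by
        simp [dixonCert, invFactorial_of_neg (show ((a : ℤ) + -N) < 0 by omega)]
      rw [e1, e2, sub_zero]
    rw [Finset.sum_sub_distrib, ← Finset.mul_sum, ← Finset.mul_sum, sub_eq_zero] at key
    have hpos : 0 < ((a : ℚ) + b + c + 1) * ∑ i ∈ range (2 * N + 1),
        dixonTerm a b c ((i : ℤ) - N) := mul_pos (by positivity) ih
    rw [← key] at hpos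
    push_cast
    exact pos_of_mul_pos_right hpos (by positivity)

/-- Divided powers `z ^ n / n!`, extended by zero to negative exponents. -/
noncomputable def divPow {R : Type*} [CommRing R] [Algebra ℚ R] (n : ℤ) (z : R) : R :=
  invFactorial n • z ^ n.toNat

lemma Derivation.map_divPow {R : Type*} [CommRing R] [Algebra ℚ R] (D : Derivation ℚ R R)
    (n : ℤ) (z : R) : D (divPow n z) = divPow (n - 1) z * D z := by
  unfold divPow
  rw [invFactorial_sub_one, D.map_smul, D.leibniz_pow]
  rcases le_or_gt n 0 with h | h
  · rcases h.lt_or_eq with h | rfl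
    · simp [invFactorial_of_neg h]
    · simp
  · obtain ⟨m, rfl⟩ : ∃ m : ℕ, n = m + 1 := ⟨(n - 1).toNat, by omega⟩
    have h1 : ((m : ℤ) + 1).toNat = m + 1 := by omega
    rw [h1]
    simp only [add_sub_cancel_right, Int.toNat_natCast, Nat.add_sub_cancel, smul_eq_mul,
      Algebra.smul_def]
    simp
    ring

lemma map_divPow {R S : Type*} [CommRing R] [Algebra ℚ R] [CommRing S] [Algebra ℚ S]
    (φ : R →ₐ[ℚ] S) (n : ℤ) (z : R) : φ (divPow n z) = divPow n (φ z) := by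
  simp [divPow]

lemma mul_divPow_self {R : Type*} [CommRing R] [Algebra ℚ R] (n : ℤ) (z : R) :
    divPow (n - 1) z * z = (n : ℚ) • divPow n z := by
  unfold divPow
  rw [invFactorial_sub_one]
  rcases lt_trichotomy n 0 with h | rfl | h
  · simp [invFactorial_of_neg h]
  · simp
  · obtain ⟨m, rfl⟩ : ∃ m : ℕ, n = m + 1 := ⟨(n - 1).toNat, by omega⟩
    have h1 : ((m : ℤ) + 1).toNat = m + 1 := by omega
    rw [h1]
    simp [smul_smul, pow_succ]

/-- The product of divided powers of `cx`, `cy`, `dx`, `dy`. -/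
noncomputable def linDivMonomial (a b i j : ℤ) : MvPolynomial (Fin 8) ℚ :=
  divPow a cx * divPow b cy * divPow i dx * divPow j dy

lemma Omega_apply (g : MvPolynomial (Fin 8) ℚ) :
    Omega g = pderiv 0 (pderiv 3 g) - pderiv 2 (pderiv 1 g) := rfl

lemma Omega_linDivMonomial (a b i j : ℤ) :
    Omega (linDivMonomial a b i j) =
      cd * (linDivMonomial (a - 1) b i (j - 1) - linDivMonomial a (b - 1) (i - 1) j) := by
  have h0 : pderiv 0 cx = X 4 ∧ pderiv 0 cy = 0 ∧ pderiv 0 dx = X 6 ∧ pderiv 0 dy = 0 := by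
    simp [cx, cy, dx, dy, pderiv_X]
  have h1 : pderiv 1 cx = X 5 ∧ pderiv 1 cy = 0 ∧ pderiv 1 dx = X 7 ∧ pderiv 1 dy = 0 := by
    simp [cx, cy, dx, dy, pderiv_X]
  have h2 : pderiv 2 cx = 0 ∧ pderiv 2 cy = X 4 ∧ pderiv 2 dx = 0 ∧ pderiv 2 dy = X 6 := by
    simp [cx, cy, dx, dy, pderiv_X]
  have h3 : pderiv 3 cx = 0 ∧ pderiv 3 cy = X 5 ∧ pderiv 3 dx = 0 ∧ pderiv 3 dy = X 7 := by
    simp [cx, cy, dx, dy, pderiv_X]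
  simp only [Omega_apply, linDivMonomial, Derivation.leibniz, Derivation.map_divPow, h0, h1, h2, h3,
    smul_eq_mul, map_add, mul_zero, add_zero, zero_add]
  simp
  unfold cd
  ring

lemma Omega_cd_mul (g : MvPolynomial (Fin 8) ℚ) : Omega (cd * g) = cd * Omega g := by
  have h : pderiv 0 cd = 0 ∧ pderiv 1 cd = 0 ∧ pderiv 2 cd = 0 ∧ pderiv 3 cd = 0 := by
    simp [cd, pderiv_X]
  simp [Omega_apply, Derivation.leibniz, h]
  ring

lemma Omega_cd_pow_mul (n : ℕ) (g : MvPolynomial (Fin 8) ℚ) :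
    Omega (cd ^ n * g) = cd ^ n * Omega g := by
  induction n with
  | zero => simp
  | succ n ih => rw [pow_succ', mul_assoc, Omega_cd_mul, ih, mul_assoc]

lemma Omega_pow_linDivMonomial (a b i j : ℤ) (n : ℕ) :
    (Omega ^ n) (linDivMonomial a b i j) = cd ^ n * ∑ s ∈ antidiagonal n, n.choose s.1 •
      ((-1 : ℚ) ^ s.2 • linDivMonomial (a - s.1) (b - s.2) (i - s.2) (j - s.1)) := by
  induction n with
  | zero => simp
  | succ n ih =>
    rw [pow_succ', Module.End.mul_apply, ih, Omega_cd_pow_mul,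
      sum_antidiagonal_choose_succ_nsmul
        (fun s t => (-1 : ℚ) ^ t • linDivMonomial (a - s) (b - t) (i - t) (j - s)),
      pow_succ, mul_assoc, map_sum, ← Finset.sum_add_distrib, Finset.mul_sum _ _ cd]
    congr 1
    refine Finset.sum_congr rfl fun s hs => ?_
    have hc : n.choose s.2 = n.choose s.1 := by
      rw [← mem_antidiagonal.1 hs]
      exact (Nat.choose_symm_add).symm
    rw [map_nsmul, map_smul, Omega_linDivMonomial, hc]
    push_cast
    simp only [sub_add_eq_sub_sub, pow_succ, Algebra.smul_def]
    simp
    ring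

/-- The Euler operator in the variables `x₀, x₁, y₀, y₁`. -/
noncomputable def euler : Derivation ℚ (MvPolynomial (Fin 8) ℚ) (MvPolynomial (Fin 8) ℚ) :=
  (X 0 : MvPolynomial (Fin 8) ℚ) • pderiv 0 + (X 1 : MvPolynomial (Fin 8) ℚ) • pderiv 1 +
    (X 2 : MvPolynomial (Fin 8) ℚ) • pderiv 2 + (X 3 : MvPolynomial (Fin 8) ℚ) • pderiv 3

lemma euler_apply (g : MvPolynomial (Fin 8) ℚ) :
    euler g = X 0 * pderiv 0 g + X 1 * pderiv 1 g + X 2 * pderiv 2 g + X 3 * pderiv 3 g := rfl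

lemma euler_linDivMonomial (a b i j : ℤ) :
    euler (linDivMonomial a b i j) = ((a + b + i + j : ℤ) : ℚ) • linDivMonomial a b i j := by
  have h : euler cx = cx ∧ euler cy = cy ∧ euler dx = dx ∧ euler dy = dy := by
    simp [euler_apply, cx, cy, dx, dy, pderiv_X]
    refine ⟨?_, ?_, ?_, ?_⟩ <;> ring
  simp only [linDivMonomial, Derivation.leibniz, Derivation.map_divPow, h, mul_divPow_self]
  simp only [Algebra.smul_def]
  simp
  ring

lemma C_two {σ : Type*} : (C 2 : MvPolynomial σ ℚ) = 2 := map_ofNat C 2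

lemma euler_omega_mul {D : ℚ} {g : MvPolynomial (Fin 8) ℚ} (h : euler g = D • g) :
    euler (ω * g) = (D + 2) • (ω * g) := by
  have hω : euler ω = 2 * ω := by
    simp [euler_apply, ω, pderiv_X]
    ring
  rw [Derivation.leibniz, h, hω]
  simp [Algebra.smul_def, C_two]
  ring

lemma pderiv_swap {σ R : Type*} [CommRing R] (i j : σ) (g : MvPolynomial σ R) :
    pderiv i (pderiv j g) = pderiv j (pderiv i g) := by
  classical
  have h : ⁅pderiv (R := R) i, pderiv (R := R) j⁆ = 0 := by
    refine MvPolynomial.derivation_ext fun k => ?_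
    simp [Derivation.commutator_apply, pderiv_X, Pi.single_apply, apply_ite]
  rw [← sub_eq_zero, ← Derivation.commutator_apply, h, Derivation.zero_apply]

lemma euler_Omega {D : ℚ} {g : MvPolynomial (Fin 8) ℚ} (h : euler g = D • g) :
    euler (Omega g) = (D - 2) • Omega g := by
  have key : Omega (euler g) = euler (Omega g) + 2 * Omega g := by
    simp only [euler_apply, Omega_apply, map_add, map_sub, Derivation.leibniz, smul_eq_mul,
      pderiv_X, Pi.single_apply]
    simp
    have hswap (i j : Fin 8) := pderiv_swap (R := ℚ) i j
    simp only [hswap 1 0, hswap 2 0, hswap 3 0, hswap 2 1, hswap 3 1, hswap 3 2]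
    ring
  rw [h, map_smul] at key
  rw [sub_smul, key, ofNat_smul_eq_nsmul]
  simp

lemma Omega_omega_mul (g : MvPolynomial (Fin 8) ℚ) :
    Omega (ω * g) = ω * Omega g + euler g + 2 * g := by
  simp only [euler_apply, Omega_apply, ω, map_add, map_sub, Derivation.leibniz, smul_eq_mul,
      pderiv_X, Pi.single_apply]
  simp
  rw [pderiv_swap 2 1]
  ring

lemma euler_Omega_pow {D : ℚ} {g : MvPolynomial (Fin 8) ℚ} (h : euler g = D • g) (n : ℕ) :
    euler ((Omega ^ n) g) = (D - 2 * n) • (Omega ^ n) g := by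
  induction n with
  | zero => simpa using h
  | succ n ih =>
    rw [pow_succ', Module.End.mul_apply, euler_Omega ih]
    push_cast
    ring_nf

lemma Omega_pow_omega_mul {D : ℚ} {g : MvPolynomial (Fin 8) ℚ} (h : euler g = D • g) (n : ℕ) :
    (Omega ^ (n + 1)) (ω * g) = ω * (Omega ^ (n + 1)) g +
      ((n + 1) * (D + 2 - n)) • (Omega ^ n) g := by
  induction n with
  | zero =>
    simp [Omega_omega_mul, h, Algebra.smul_def, C_two]
    ring
  | succ n ih =>
    rw [pow_succ', Module.End.mul_apply, ih, map_add, Omega_omega_mul, map_smul,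
      euler_Omega_pow h, ← Module.End.mul_apply, ← pow_succ', ← Module.End.mul_apply, ← pow_succ']
    simp [Algebra.smul_def, C_two]
    ring

/-- The substitution `y := x`. -/
noncomputable abbrev restrictDiagonal :
    MvPolynomial (Fin 8) ℚ →ₐ[ℚ] MvPolynomial (Fin 8) ℚ :=
  aeval (![X 0, X 1, X 0, X 1, X 4, X 5, X 6, X 7] : Fin 8 → MvPolynomial (Fin 8) ℚ)

lemma restrictDiagonal_omega : restrictDiagonal ω = 0 := by
  simp [restrictDiagonal, ω]
  ring

lemma exists_pos_restrictDiagonal_Omega_pow (b n D : ℕ) (hD : n ≤ D)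
    {f : MvPolynomial (Fin 8) ℚ} (hf : euler f = (D : ℚ) • f) :
    ∃ K : ℚ, 0 < K ∧ restrictDiagonal ((Omega ^ (n + b)) (ω ^ b * f)) =
      K • restrictDiagonal ((Omega ^ n) f) := by
  have hdeg (b : ℕ) : euler (ω ^ b * f) = ((D : ℚ) + 2 * b) • (ω ^ b * f) := by
    induction b with
    | zero => simpa using hf
    | succ b ih =>
      rw [pow_succ', mul_assoc, euler_omega_mul ih]
      push_cast
      ring_nf
  induction b with
  | zero => exact ⟨1, one_pos, by simp⟩
  | succ b ih =>
    obtain ⟨K, hK, hK'⟩ := ih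
    have hlt : (n : ℚ) ≤ D := by exact_mod_cast hD
    refine ⟨((n + b : ℕ) + 1) * (D + 2 * b + 2 - (n + b : ℕ)) * K, ?_, ?_⟩
    · have : (0 : ℚ) < D + 2 * b + 2 - (n + b : ℕ) := by
        push_cast
        have : (0 : ℚ) ≤ b := by positivity
        linarith
      positivity
    · rw [← add_assoc, pow_succ' ω, mul_assoc, Omega_pow_omega_mul (hdeg b), map_add, map_mul,
        restrictDiagonal_omega, zero_mul, zero_add, map_smul, hK', smul_smul]

lemma restrictDiagonal_linDivMonomial {m e k s t : ℕ} (hst : s + t = 2 * k) (hm : k ≤ m)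
    (he : k ≤ e) :
    restrictDiagonal (linDivMonomial (m - s) (m - t) (e - t) (e - s)) =
      (invFactorial (m - s) * invFactorial (m - t) * invFactorial (e - t) * invFactorial (e - s)) •
        (cx ^ (2 * (m - k)) * dx ^ (2 * (e - k))) := by
  have hx : restrictDiagonal cx = cx ∧ restrictDiagonal cy = cx ∧ restrictDiagonal dx = dx ∧
      restrictDiagonal dy = dx := by
    simp [restrictDiagonal, cx, cy, dx, dy]
  simp only [linDivMonomial, map_mul, map_divPow, hx]
  rcases lt_or_ge m s with h | h1
  · simp [divPow, invFactorial_of_neg (show (m : ℤ) - s < 0 by omega)]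
  rcases lt_or_ge m t with h | h2
  · simp [divPow, invFactorial_of_neg (show (m : ℤ) - t < 0 by omega)]
  rcases lt_or_ge e s with h | h3
  · simp [divPow, invFactorial_of_neg (show (e : ℤ) - s < 0 by omega)]
  rcases lt_or_ge e t with h | h4
  · simp [divPow, invFactorial_of_neg (show (e : ℤ) - t < 0 by omega)]
  have e1 : 2 * (m - k) = ((m : ℤ) - s).toNat + ((m : ℤ) - t).toNat := by omega
  have e2 : 2 * (e - k) = ((e : ℤ) - s).toNat + ((e : ℤ) - t).toNat := by omega
  rw [e1, e2, pow_add, pow_add]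
  simp only [divPow, Algebra.smul_def, map_mul]
  ring

lemma restrictDiagonal_Omega_pow_linDivMonomial (m e k : ℕ) (hm : k ≤ m) (he : k ≤ e) :
    restrictDiagonal ((Omega ^ (2 * k)) (linDivMonomial m m e e)) =
      ((-1) ^ k * ((2 * k).factorial : ℚ) * ∑ i ∈ range (2 * k + 1),
        dixonTerm k (m - k : ℕ) (e - k : ℕ) ((i : ℤ) - k)) •
        (cd ^ (2 * k) * cx ^ (2 * (m - k)) * dx ^ (2 * (e - k))) := by
  have hcd : restrictDiagonal cd = cd := by simp [restrictDiagonal, cd]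
  rw [Omega_pow_linDivMonomial, map_mul, map_pow, hcd, map_sum, mul_assoc (cd ^ _), ← mul_smul_comm,
    Finset.mul_sum _ _ (_ * _), Finset.sum_smul, ← Finset.Nat.sum_antidiagonal_swap,
    Finset.Nat.sum_antidiagonal_eq_sum_range_succ_mk]
  congr 1
  refine Finset.sum_congr rfl fun i hi => ?_
  have hi : i ≤ 2 * k := by simpa [Nat.lt_succ_iff] using hi
  simp only [Prod.swap]
  rw [map_nsmul, map_smul, restrictDiagonal_linDivMonomial (k := k) (by omega) hm he,
    ← Nat.cast_smul_eq_nsmul ℚ, smul_smul, smul_smul]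
  congr 1
  have hsign : (-1 : ℚ) ^ k * (-1) ^ ((i : ℤ) - k) = (-1) ^ i := by
    rw [← zpow_natCast, ← zpow_add₀ (by norm_num), ← zpow_natCast]
    congr 1
    ring
  have hch : ((2 * k).choose (2 * k - i) : ℚ) =
      (2 * k).factorial * (invFactorial i * invFactorial ((2 * k - i : ℕ))) := by
    rw [Nat.choose_symm hi, Nat.cast_choose ℚ hi, invFactorial_natCast, invFactorial_natCast]
    field_simp
  rw [hch, ← hsign, dixonTerm]
  have c1 : ((2 * k - i : ℕ) : ℤ) = 2 * k - i := by omega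
  have c2 : ((m - k : ℕ) : ℤ) = m - k := by omega
  have c3 : ((e - k : ℕ) : ℤ) = e - k := by omega
  rw [c1, c2, c3, show (k : ℤ) + (i - k) = i by ring, show (k : ℤ) - (i - k) = 2 * k - i by ring,
    show (m : ℤ) - k + (i - k) = m - (2 * k - i) by ring,
    show (m : ℤ) - k - (i - k) = m - i by ring,
    show (e : ℤ) - k + (i - k) = e - (2 * k - i) by ring,
    show (e : ℤ) - k - (i - k) = e - i by ring]
  ring

theorem stmt_12 (r e p p' : ℕ) (hr : 2 ≤ r) (he : 1 ≤ e)
    (hp : 2 * p ≤ r * e) (hp' : 2 * p' ≤ (r + 1) * e)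
    (hpp' : p ≤ p') (hp'pe : p' ≤ p + e) (hsum : p' + p ≤ r * e) :
    ∃ N : ℚ, N ≠ 0 ∧
      MvPolynomial.aeval
          (![X 0, X 1, X 0, X 1, X 4, X 5, X 6, X 7] : Fin 8 → MvPolynomial (Fin 8) ℚ)
          ((Omega ^ (2 * p'))
            (ω ^ (2 * p) * cx ^ (r * e - 2 * p) * cy ^ (r * e - 2 * p) * dx ^ e * dy ^ e))
        = MvPolynomial.C N * cd ^ (2 * (p' - p)) * cx ^ (2 * (r * e - p' - p)) *
            dx ^ (2 * (e - (p' - p))) := by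
  obtain ⟨k, rfl⟩ := Nat.exists_eq_add_of_le hpp'
  obtain ⟨m, hm⟩ := Nat.exists_eq_add_of_le hp
  have hkm : k ≤ m := by omega
  have hke : k ≤ e := by omega
  rw [hm, show 2 * p + m - 2 * p = m by omega, show p + k - p = k by omega,
    show 2 * p + m - (p + k) - p = m - k by omega, show 2 * (p + k) = 2 * k + 2 * p by ring]
  have heul : euler (linDivMonomial m m e e) = ((2 * m + 2 * e : ℕ) : ℚ) • linDivMonomial m m e e := by
    rw [euler_linDivMonomial]
    congr 1
    push_cast
    ring
  obtain ⟨K, hK, hK'⟩ := exists_pos_restrictDiagonal_Omega_pow (2 * p) (2 * k) (2 * m + 2 * e)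
    (by omega) heul
  have hS := sum_dixonTerm_pos k (m - k) (e - k) k le_rfl
  have hmono : ω ^ (2 * p) * cx ^ m * cy ^ m * dx ^ e * dy ^ e =
      ((m.factorial : ℚ) ^ 2 * (e.factorial : ℚ) ^ 2) •
        (ω ^ (2 * p) * linDivMonomial m m e e) := by
    have h (n : ℕ) (z : MvPolynomial (Fin 8) ℚ) : z ^ n = (n.factorial : ℚ) • divPow n z := by
      have : (n.factorial : ℚ) ≠ 0 := by positivity
      simp [divPow, invFactorial_natCast, smul_smul, this]
    rw [h m cx, h m cy, h e dx, h e dy, linDivMonomial]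
    simp only [Algebra.smul_def, map_mul, map_pow]
    ring
  refine ⟨(m.factorial : ℚ) ^ 2 * (e.factorial : ℚ) ^ 2 * K * ((-1) ^ k *
    ((2 * k).factorial : ℚ) * ∑ i ∈ range (2 * k + 1),
      dixonTerm k (m - k : ℕ) (e - k : ℕ) ((i : ℤ) - k)), ?_, ?_⟩
  · have : ((-1 : ℚ)) ^ k ≠ 0 := by simp
    have := hS.ne'
    positivity
  · rw [hmono, map_smul, map_smul]
    change _ • restrictDiagonal _ = _
    rw [hK', restrictDiagonal_Omega_pow_linDivMonomial m e k hkm hke, smul_smul, smul_smul,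
      smul_eq_C_mul]
    ring
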